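/- There exists a grammar/observer system Ω = (G, A), with G a context-free grammar, such that the (unfiltered) language L_f(Ω) is not recursive (not decidable). (This follows because recursive languages are closed under intersection with regular languages, while L_{⊥,f}(Ω) = L_f(Ω) ∩ Σ* ranges over all recursively enumerable languages.) -/

import Mathlib

/-!  Common definitions for "computing by observing" G/O systems.

A monadic transducer with input alphabet `V` and output alphabet `Γ` is modelled by its
input/output function `A : List V → Option Γ` (`none` standing for the empty output `λ`),
together with the property `ObserverRegular A` saying that every fiber of `A` is a regular
language (equivalently, `A` is computed by a complete deterministic finite automaton whose
states are labelled by `Γ ∪ {λ}`).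

For a G/O system the output alphabet is `Σ ∪ {⊥}`, modelled as `Option Sig` with
`none` standing for `⊥`; hence observers of G/O systems have type
`List (Symbol T G.NT) → Option (Option Sig)`. -/

/-- Every fiber of the transducer map is a regular language (and the fibers obviously
partition `V*`): this characterizes maps computed by complete deterministic finite
automata with output-labelled states, i.e. monadic transducers. -/
def ObserverRegular {V Γ : Type*} (A : List V → Option Γ) : Prop :=
  ∀ o : Option Γ, Language.IsRegular ({ w : List V | A w = o } : Language V)

/-- The number of occurrences of nonterminal symbols in a sentential form. -/
def nonterminalCount {T NT : Type*} (w : List (Symbol T NT)) : ℕ :=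
  (w.filter fun s => match s with | Symbol.nonterminal _ => true | _ => false).length

/-- The language `L_f(Ω)` (free mode) of the G/O system `Ω = (G, A)`, a language over the
alphabet `Σ ∪ {⊥}` (= `Option Sig`, `none` being `⊥`): all concatenations
`A(w₀)A(w₁)⋯A(wₙ)` of observer outputs along terminating derivations
`S = w₀ ⇒ w₁ ⇒ ⋯ ⇒ wₙ` of `G` with `wₙ` consisting of terminals only. -/
def goLang {T : Type} (G : ContextFreeGrammar T) {Sig : Type}
    (A : List (Symbol T G.NT) → Option (Option Sig)) : Language (Option Sig) :=
  { x | ∃ ws : List (List (Symbol T G.NT)),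
      ws.head? = some [Symbol.nonterminal G.initial] ∧
      List.Chain' G.Produces ws ∧
      (∃ t : List T, ws.getLast? = some (t.map Symbol.terminal)) ∧
      x = (ws.map fun w => (A w).toList).flatten }

/-- The language `L_{⊥,f}(Ω) = L_f(Ω) ∩ Σ*`: the words of `L_f(Ω)` containing no `⊥`,
viewed as a language over `Σ`. -/
def goLangBot {T : Type} (G : ContextFreeGrammar T) {Sig : Type}
    (A : List (Symbol T G.NT) → Option (Option Sig)) : Language Sig :=
  { x | (x.map some) ∈ goLang G A }

open Turing

def eOnes (k : ℕ) : ℕ := Nat.rec 0 (fun _ n => 2 * n + 1) k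

theorem eOnes_zero : eOnes 0 = 0 := rfl
theorem eOnes_succ (k : ℕ) : eOnes (k+1) = 2 * eOnes k + 1 := rfl

theorem eOnes_lt (k : ℕ) : eOnes k < eOnes (k+1) := by
  rw [eOnes_succ]; omega

theorem eOnes_inj : Function.Injective eOnes :=
  (strictMono_nat_of_lt_succ eOnes_lt).injective

theorem eOnes_primrec : Primrec eOnes := by
  refine Primrec.nat_rec₁ 0 ?_
  refine Primrec.succ.comp (Primrec.nat_mul.comp (Primrec.const 2) Primrec.snd)

theorem trNat_eOnes (k : ℕ) :
    PartrecToTM2.trNat (eOnes k) = List.replicate k PartrecToTM2.Γ'.bit1 := by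
  induction k with
  | zero => rw [eOnes_zero]; simp
  | succ k ih =>
    rw [eOnes_succ, List.replicate_succ, ← ih]
    unfold PartrecToTM2.trNat
    have h : ((2 * eOnes k + 1 : ℕ) : Num) = ((eOnes k : ℕ) : Num).bit1 := by
      rw [← Num.bit1_of_bit1]; push_cast; ring
    rw [h]
    cases ((eOnes k : ℕ) : Num) <;> rfl

noncomputable def fOnes : ℕ →. ℕ := fun n =>
  (Nat.rfind fun k => Part.some (decide (eOnes k = n))).bind fun k =>
    Nat.Partrec.Code.eval (Denumerable.ofNat Nat.Partrec.Code k) 0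

theorem fOnes_partrec : Partrec fOnes := by
  refine Partrec.bind (Partrec.rfind ?_) ?_
  · refine Computable.partrec (σ := Bool) (f := fun p : ℕ × ℕ => decide (eOnes p.2 = p.1)) ?_
    have : PrimrecPred (fun p : ℕ × ℕ => eOnes p.2 = p.1) :=
      PrimrecRel.comp Primrec.eq (eOnes_primrec.comp Primrec.snd) Primrec.fst
    exact this.decide.to_comp
  · exact Nat.Partrec.Code.eval_part.comp₂ 
      ((Computable.ofNat _).comp Computable.snd).to₂ (Computable.const 0).to₂

theorem fOnes_dom (k : ℕ) : (fOnes (eOnes k)).Dom ↔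
    (Nat.Partrec.Code.eval (Denumerable.ofNat Nat.Partrec.Code k) 0).Dom := by
  have : (Nat.rfind fun j => Part.some (decide (eOnes j = eOnes k))) = Part.some k := by
    rw [Part.eq_some_iff]
    refine Nat.mem_rfind.2 ?_
    refine ⟨by simp, ?_⟩
    intro m hm
    have := eOnes_inj.ne hm.ne
    simp [this]
  unfold fOnes
  rw [this, Part.bind_some]

theorem halts_undec : ¬ ComputablePred fun k : ℕ => (fOnes (eOnes k)).Dom := by
  intro h
  refine ComputablePred.halting_problem 0 ?_
  have := ComputablePred.computable_of_manyOneReducible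
    (p := fun c : Nat.Partrec.Code => (Nat.Partrec.Code.eval c 0).Dom) ⟨Encodable.encode, Computable.encode, fun c => ?_⟩ h
  · exact this
  · rw [fOnes_dom]; simp

theorem exists_TM2 : ∃ c : ToPartrec.Code, ∀ k,
   (StateTransition.eval (TM2.step PartrecToTM2.tr) (PartrecToTM2.init c [eOnes k])).Dom ↔
     (fOnes (eOnes k)).Dom := by
  have h : Nat.Partrec' (n := 1) (fun v => fOnes v.head) := Nat.Partrec'.part_iff₁.2 fOnes_partrec
  obtain ⟨c, hc⟩ := ToPartrec.Code.exists_code h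
  refine ⟨c, fun k => ?_⟩
  rw [PartrecToTM2.tr_eval]
  have := hc ⟨[eOnes k], rfl⟩
  simp only at this
  rw [this]
  rfl
instance finite_K' : Finite PartrecToTM2.K' := by
  refine Finite.of_surjective (α := Fin 4) ![.main, .rev, .aux, .stack] ?_
  intro x
  cases x
  exacts [⟨0, rfl⟩, ⟨1, rfl⟩, ⟨2, rfl⟩, ⟨3, rfl⟩]

instance finite_Gam' : Finite (TM2to1.Γ' PartrecToTM2.K' fun _ => PartrecToTM2.Γ') := by
  unfold TM2to1.Γ'
  infer_instance

theorem exists_TM0 (c : ToPartrec.Code) : 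
    ∃ (Γ Λ : Type) (_ : Inhabited Γ) (_ : Inhabited Λ) (_ : Finite Γ) (_ : Finite Λ)
      (M : TM0.Machine Γ Λ) (g0 g1 : Γ), g1 ≠ default ∧ ∀ k : ℕ,
      ((StateTransition.eval (TM0.step M) (TM0.init (g0 :: List.replicate k g1))).Dom ↔
      (StateTransition.eval (TM2.step PartrecToTM2.tr) (PartrecToTM2.init c [eOnes k])).Dom) := by
  classical
  let _ : Inhabited PartrecToTM2.Λ' := ⟨PartrecToTM2.trNormal c PartrecToTM2.Cont'.halt⟩
  have s2 : TM2.Supports PartrecToTM2.tr (PartrecToTM2.codeSupp c PartrecToTM2.Cont'.halt) :=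
    PartrecToTM2.tr_supports c _
  have s1 := TM2to1.tr_supports PartrecToTM2.tr s2
  have s0 := TM1to0.tr_supports _ s1
  have hdom : ∀ k : ℕ, (TM0.eval (TM1to0.tr (TM2to1.tr PartrecToTM2.tr)) (TM2to1.trInit PartrecToTM2.K'.main (PartrecToTM2.trList [eOnes k]))).Dom ↔ (StateTransition.eval (TM2.step PartrecToTM2.tr) (PartrecToTM2.init c [eOnes k])).Dom := by
    intro k
    rw [TM1to0.tr_eval]
    refine (TM2to1.tr_eval_dom _ _ _).trans ?_
    unfold TM2.eval
    have : (TM2.init PartrecToTM2.K'.main (PartrecToTM2.trList [eOnes k]) : PartrecToTM2.Cfg')  = PartrecToTM2.init c [eOnes k] := by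
      unfold TM2.init PartrecToTM2.init
      congr 1
      funext x
      cases x <;> rfl
    rw [← this]
    rfl
  generalize hM : (TM1to0.tr (TM2to1.tr PartrecToTM2.tr)) = M at *
  generalize hS : TM1to0.trStmts (TM2to1.tr PartrecToTM2.tr) (TM2to1.trSupp PartrecToTM2.tr (PartrecToTM2.codeSupp c PartrecToTM2.Cont'.halt)) = S at *
  let S' := {x // x ∈ S}
  let _ : Inhabited S' := ⟨⟨default, s0.1⟩⟩
  let g₁ : PointedMap (TM1to0.Λ' (TM2to1.tr PartrecToTM2.tr)) S' := 
    ⟨fun q => if h : q ∈ S then ⟨q, h⟩ else default, by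
      rw [dif_pos (by exact s0.1)]; rfl⟩
  have resp := TM0.Machine.map_respects M ⟨id, rfl⟩ ⟨id, rfl⟩ g₁ (fun q : S' => q.1) s0 (fun _ => rfl)
     (by
      intro q hq
      have hq : q ∈ S := hq
      show (dite _ _ _ : S').1 = q
      rw [dif_pos hq])
  refine ⟨_, S', inferInstance, inferInstance, inferInstance, inferInstance, TM0.Machine.map M ⟨id, rfl⟩ ⟨id, rfl⟩ g₁ (fun q : S' => q.1), (true, Function.update (fun _ => none) PartrecToTM2.K'.main (some PartrecToTM2.Γ'.cons)), (false, Function.update (fun _ => none) PartrecToTM2.K'.main (some PartrecToTM2.Γ'.bit1)), ?_, ?_⟩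
  · intro h
    have := congrFun (congrArg Prod.snd h) PartrecToTM2.K'.main
    simp at this
  · intro k
    rw [← hdom]
    have e : TM2to1.trInit (Γ := fun _ => PartrecToTM2.Γ') PartrecToTM2.K'.main (PartrecToTM2.trList [eOnes k]) = (true, Function.update (fun _ => none) PartrecToTM2.K'.main (some PartrecToTM2.Γ'.cons)) :: List.replicate k (false, Function.update (fun _ => none) PartrecToTM2.K'.main (some PartrecToTM2.Γ'.bit1)) := by
      simp [TM2to1.trInit, trNat_eOnes]
      exact congrArg (List.cons _) List.map_replicate
    have := StateTransition.tr_eval_dom resp (a₁ := TM0.init (TM2to1.trInit (Γ := fun _ => PartrecToTM2.Γ') PartrecToTM2.K'.main (PartrecToTM2.trList [eOnes k]))) ⟨s0.1, rfl⟩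
    rw [TM0.map_init, e] at this
    rw [e]
    have e2 := List.map_id ((true, Function.update (fun _ => none) PartrecToTM2.K'.main (some PartrecToTM2.Γ'.cons)) :: List.replicate k (false, Function.update (fun _ => none) PartrecToTM2.K'.main (some PartrecToTM2.Γ'.bit1)) : List (TM2to1.Γ' PartrecToTM2.K' fun _ => PartrecToTM2.Γ'))
    exact (iff_of_eq (congrArg (fun l => (StateTransition.eval (TM0.step (M.map ⟨id, rfl⟩ ⟨id, rfl⟩ g₁.f fun q : S' => q.1)) (TM0.init l)).Dom) e2)).symm.trans this


namespace GO

open Turing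

inductive NTm (Γ Λ : Type) : Type
  | S | Y | X | E
  | tp (a : Γ)
  | hd (q : Λ) (a : Γ)

inductive St (Γ Λ : Type) : Type
  | init | s | y | yE | pre | post | fin | dead | H
  | h1 (q : Λ) (a : Γ)

instance finNTm {Γ Λ : Type} [Finite Γ] [Finite Λ] : Finite (NTm Γ Λ) := by
  refine Finite.of_surjective (α := Fin 4 ⊕ Γ ⊕ Λ × Γ)
    (Sum.elim ![.S, .Y, .X, .E] (Sum.elim .tp (fun p => .hd p.1 p.2))) ?_
  intro x
  cases x with
  | S => exact ⟨.inl 0, rfl⟩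
  | Y => exact ⟨.inl 1, rfl⟩
  | X => exact ⟨.inl 2, rfl⟩
  | E => exact ⟨.inl 3, rfl⟩
  | tp a => exact ⟨.inr (.inl a), rfl⟩
  | hd q a => exact ⟨.inr (.inr (q, a)), rfl⟩

instance finSt {Γ Λ : Type} [Finite Γ] [Finite Λ] : Finite (St Γ Λ) := by
  refine Finite.of_surjective (α := Fin 9 ⊕ Λ × Γ)
    (Sum.elim ![.init, .s, .y, .yE, .pre, .post, .fin, .dead, .H] (fun p => .h1 p.1 p.2)) ?_
  intro x
  cases x with
  | init => exact ⟨.inl 0, rfl⟩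
  | s => exact ⟨.inl 1, rfl⟩
  | y => exact ⟨.inl 2, rfl⟩
  | yE => exact ⟨.inl 3, rfl⟩
  | pre => exact ⟨.inl 4, rfl⟩
  | post => exact ⟨.inl 5, rfl⟩
  | fin => exact ⟨.inl 6, rfl⟩
  | dead => exact ⟨.inl 7, rfl⟩
  | H => exact ⟨.inl 8, rfl⟩
  | h1 q a => exact ⟨.inr (q, a), rfl⟩

abbrev Sy (Γ Λ : Type) : Type := Symbol Bool (NTm Γ Λ)

abbrev nt {Γ Λ : Type} (n : NTm Γ Λ) : Sy Γ Λ := Symbol.nonterminal n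

def tps {Γ Λ : Type} (u : List Γ) : List (Sy Γ Λ) := u.map fun a => nt (.tp a)

section
variable {Γ Λ : Type}

@[simp] theorem tps_nil : (tps [] : List (Sy Γ Λ)) = [] := rfl
@[simp] theorem tps_cons (a : Γ) (u : List Γ) :
    (tps (a :: u) : List (Sy Γ Λ)) = nt (.tp a) :: tps u := rfl
@[simp] theorem tps_append (u v : List Γ) :
    (tps (u ++ v) : List (Sy Γ Λ)) = tps u ++ tps v := by simp [tps]
@[simp] theorem term_not_mem_tps (b : Bool) (u : List Γ) :
    Symbol.terminal b ∉ (tps u : List (Sy Γ Λ)) := by simp [tps]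

variable [Inhabited Γ] [Inhabited Λ] (M : TM0.Machine Γ Λ) (g0 g1 : Γ)

def adj (p : Λ) (c : Γ) (r : Λ) (d : Γ) : Prop :=
  M p c = some (r, .move .right) ∨ M r d = some (p, .move .left)

open Classical in
noncomputable def stepN : St Γ Λ → NTm Γ Λ → St Γ Λ
  | .H, _ => .H
  | .init, .S => .s
  | .init, .Y => .y
  | .init, .X => .pre
  | .y, .tp a => if a = g1 then .y else .dead
  | .y, .E => .yE
  | .pre, .tp _ => .pre
  | .pre, .hd q a => .h1 q a
  | .h1 _ _, .tp _ => .post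
  | .h1 _ _, .E => .fin
  | .h1 p c, .hd r d => if adj M p c r d then .post else .dead
  | .post, .tp _ => .post
  | .post, .E => .fin
  | _, _ => .dead

noncomputable def stepS (s : St Γ Λ) : Sy Γ Λ → St Γ Λ
  | .terminal true => .H
  | .terminal false => match s with
    | .H => .H
    | _ => .dead
  | .nonterminal n => stepN M g1 s n

noncomputable def run (s : St Γ Λ) (w : List (Sy Γ Λ)) : St Γ Λ := w.foldl (stepS M g1) s

@[simp] theorem run_nil (s : St Γ Λ) : run M g1 s [] = s := rfl
@[simp] theorem run_cons (s : St Γ Λ) (x : Sy Γ Λ) (w : List (Sy Γ Λ)) :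
    run M g1 s (x :: w) = run M g1 (stepS M g1 s x) w := rfl
@[simp] theorem run_append (s : St Γ Λ) (w v : List (Sy Γ Λ)) :
    run M g1 s (w ++ v) = run M g1 (run M g1 s w) v := by simp [run]

theorem run_H (w : List (Sy Γ Λ)) : run M g1 .H w = .H := by
  induction w with
  | nil => rfl
  | cons x w ih =>
    rcases x with (b | n)
    · cases b <;> exact ih
    · exact ih

theorem run_mem_h (s : St Γ Λ) (w : List (Sy Γ Λ)) (h : Symbol.terminal true ∈ w) :
    run M g1 s w = .H := by
  obtain ⟨p, q, rfl⟩ := List.append_of_mem h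
  simp [stepS, run_H]

@[simp] theorem stepN_dead (n : NTm Γ Λ) : stepN M g1 .dead n = .dead := by
  cases n <;> rfl

theorem run_dead (w : List (Sy Γ Λ)) (h : Symbol.terminal true ∉ w) :
    run M g1 .dead w = .dead := by
  induction w with
  | nil => rfl
  | cons x w ih =>
    simp only [List.mem_cons, not_or] at h
    rcases x with (b | n)
    · cases b
      · exact ih h.2
      · exact absurd rfl h.1
    · simp [stepS, ih h.2]

theorem stepN_ne_H (s : St Γ Λ) (hs : s ≠ .H) (n : NTm Γ Λ) : stepN M g1 s n ≠ .H := by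
  cases s <;> cases n <;> simp_all [stepN] <;> split <;> simp

theorem run_ne_H (s : St Γ Λ) (hs : s ≠ .H) (w : List (Sy Γ Λ)) (h : Symbol.terminal true ∉ w) :
    run M g1 s w ≠ .H := by
  induction w generalizing s with
  | nil => exact hs
  | cons x w ih =>
    simp only [List.mem_cons, not_or] at h
    refine ih _ ?_ h.2
    rcases x with (b | n)
    · cases b
      · cases s <;> simp_all [stepS]
      · exact absurd rfl h.1
    · exact stepN_ne_H _ _ _ hs _

theorem run_mem_t (w : List (Sy Γ Λ)) (h : Symbol.terminal true ∉ w)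
    (h' : Symbol.terminal false ∈ w) : run M g1 .init w = .dead := by
  obtain ⟨p, q, rfl⟩ := List.append_of_mem h'
  simp only [List.mem_append, List.mem_cons, not_or] at h
  have h2 := run_ne_H M g1 .init (by simp) p h.1
  have : stepS M g1 (run M g1 .init p) (.terminal false) = .dead := by
    generalize run M g1 .init p = s at h2
    cases s <;> simp_all [stepS]
  simp [this, run_dead _ _ _ h.2.2]

@[simp] theorem run_pre (u : List Γ) : run M g1 .pre (tps u) = .pre := by
  induction u with
  | nil => rfl
  | cons a u ih => exact ih

@[simp] theorem run_post (u : List Γ) : run M g1 .post (tps u) = .post := by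
  induction u with
  | nil => rfl
  | cons a u ih => exact ih

@[simp] theorem run_dead_tps (u : List Γ) : run M g1 .dead (tps u) = .dead := 
  run_dead _ _ _ (by simp)

@[simp] theorem run_y (k : ℕ) : run M g1 .y (tps (List.replicate k g1)) = .y := by
  induction k with
  | zero => rfl
  | succ k ih => simpa [List.replicate_succ, stepS, stepN] using ih

inductive IsRule0 : NTm Γ Λ → List (Sy Γ Λ) → Prop
  | S : IsRule0 .S [nt .Y, nt .E]
  | Y : IsRule0 .Y [nt .Y, nt (.tp g1)]
  | Yx : IsRule0 .Y [nt .X, nt (.hd default g0)]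
  | X : IsRule0 .X [nt .X, nt (.tp default)]
  | E : IsRule0 .E [nt (.tp default), nt .E]
  | act (q : Λ) (a : Γ) : IsRule0 (.tp a) [nt (.hd q a)]
  | drop (q : Λ) (a : Γ) : IsRule0 (.hd q a) [nt (.tp a)]
  | write (q : Λ) (a : Γ) (q' : Λ) (a' : Γ) (h : M q a = some (q', .write a')) :
      IsRule0 (.hd q a) [nt (.hd q' a')]
  | halt (q : Λ) (a : Γ) (h : M q a = none) : IsRule0 (.hd q a) [.terminal true]

def IsRule (n : NTm Γ Λ) (α : List (Sy Γ Λ)) : Prop :=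
  IsRule0 M g0 g1 n α ∨ α = [.terminal false]

inductive RW (R : NTm Γ Λ → List (Sy Γ Λ) → Prop) : List (Sy Γ Λ) → List (Sy Γ Λ) → Prop
  | head (n : NTm Γ Λ) (α s : List (Sy Γ Λ)) (h : R n α) : RW R (nt n :: s) (α ++ s)
  | cons (x : Sy Γ Λ) (s s' : List (Sy Γ Λ)) (h : RW R s s') : RW R (x :: s) (x :: s')

theorem RW.append {R : NTm Γ Λ → List (Sy Γ Λ) → Prop} {s s' : List (Sy Γ Λ)} (p)
    (h : RW R s s') : RW R (p ++ s) (p ++ s') := by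
  induction p with
  | nil => exact h
  | cons x p ih => exact .cons _ _ _ ih

theorem RW.at {R : NTm Γ Λ → List (Sy Γ Λ) → Prop} (p : List (Sy Γ Λ)) {n α s}
    (h : R n α) : RW R (p ++ nt n :: s) (p ++ (α ++ s)) :=
  RW.append p (.head n α s h)

theorem RW_cases {w w' : List (Sy Γ Λ)} (h : RW (IsRule M g0 g1) w w') :
    RW (IsRule0 M g0 g1) w w' ∨ (Symbol.terminal false ∈ w' ∧
      (Symbol.terminal true ∉ w → Symbol.terminal true ∉ w')) := by
  induction h with
  | head n α s h =>
    rcases h with h | rfl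
    · exact .inl (.head _ _ _ h)
    · right; simp
  | cons x s s' h ih =>
    rcases ih with h | ⟨h1, h2⟩
    · exact .inl (.cons _ _ _ h)
    · right; simp_all

theorem RW_mem_term {R : NTm Γ Λ → List (Sy Γ Λ) → Prop} {w w' : List (Sy Γ Λ)} (h : RW R w w')
    (b : Bool) (hb : Symbol.terminal b ∈ w) : Symbol.terminal b ∈ w' := by
  induction h with
  | head n α s h => simp_all
  | cons x s s' h ih => simp_all; tauto

theorem RW_tps {u : List Γ} {rest w' : List (Sy Γ Λ)}
    (h : RW (IsRule0 M g0 g1) (tps u ++ rest) w') :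
    (∃ u1 b u2 q, u = u1 ++ b :: u2 ∧ w' = tps u1 ++ nt (.hd q b) :: (tps u2 ++ rest)) ∨
    (∃ rest', RW (IsRule0 M g0 g1) rest rest' ∧ w' = tps u ++ rest') := by
  induction u generalizing w' with
  | nil => exact .inr ⟨_, h, rfl⟩
  | cons a u ih =>
    rcases h with ⟨n, α, s, h⟩ | ⟨x, s, s', h⟩
    · cases h with
      | act q a => exact .inl ⟨[], a, u, q, rfl, rfl⟩
    · rcases ih h with ⟨u1, b, u2, q, rfl, rfl⟩ | ⟨r', h2, rfl⟩
      · exact .inl ⟨a :: u1, b, u2, q, rfl, rfl⟩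
      · exact .inr ⟨r', h2, rfl⟩

theorem RW_E {w' : List (Sy Γ Λ)} (h : RW (IsRule0 M g0 g1) [nt .E] w') :
    w' = [nt (.tp default), nt .E] := by
  rcases h with ⟨n, α, s, h⟩ | ⟨x, s, s', h⟩
  · cases h; rfl
  · cases h

def cfg (u : List Γ) (q : Λ) (a : Γ) (v : List Γ) : TM0.Cfg Γ Λ :=
  ⟨q, ⟨a, ListBlank.mk u.reverse, ListBlank.mk v⟩⟩

def Halts (c : TM0.Cfg Γ Λ) : Prop := (StateTransition.eval (TM0.step M) c).Dom

theorem mk_pad (l : List Γ) : ListBlank.mk (l ++ [default]) = ListBlank.mk l := by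
  symm
  refine Quotient.sound (Or.inl ⟨1, rfl⟩)

theorem cfg_padl (u : List Γ) (q : Λ) (a : Γ) (v : List Γ) :
    cfg (default :: u) q a v = cfg u q a v := by
  unfold cfg; rw [List.reverse_cons, mk_pad]

theorem cfg_padr (u : List Γ) (q : Λ) (a : Γ) (v : List Γ) :
    cfg u q a (v ++ [default]) = cfg u q a v := by
  unfold cfg; rw [mk_pad]

theorem halts_step {c c' : TM0.Cfg Γ Λ} (h : TM0.step M c = some c') :
    Halts M c ↔ Halts M c' := by
  unfold Halts
  rw [StateTransition.reaches_eval (Relation.ReflTransGen.single h)]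

theorem step_right {p c r} (h : M p c = some (r, .move .right)) (u : List Γ) (d : Γ) (v : List Γ) :
    TM0.step M (cfg u p c (d :: v)) = some (cfg (u ++ [c]) r d v) := by
  simp [TM0.step, cfg, h, Tape.move]

theorem step_left {r d p} (h : M r d = some (p, .move .left)) (u : List Γ) (c : Γ) (v : List Γ) :
    TM0.step M (cfg (u ++ [c]) r d v) = some (cfg u p c (d :: v)) := by
  simp [TM0.step, cfg, h, Tape.move]

theorem step_write {q a q' a'} (h : M q a = some (q', .write a')) (u v : List Γ) :
    TM0.step M (cfg u q a v) = some (cfg u q' a' v) := by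
  simp [TM0.step, cfg, h, Tape.write]

theorem adj_halts {p c r d} (h : adj M p c r d) (u v : List Γ) :
    Halts M (cfg u p c (d :: v)) ↔ Halts M (cfg (u ++ [c]) r d v) := by
  rcases h with h | h
  · exact halts_step M (step_right M h _ _ _)
  · exact (halts_step M (step_left M h _ _ _)).symm

theorem halts_none {q a} (h : M q a = none) (u v : List Γ) : Halts M (cfg u q a v) := by
  unfold Halts
  refine Part.dom_iff_mem.2 ⟨_, StateTransition.mem_eval.2 ⟨Relation.ReflTransGen.refl, ?_⟩⟩
  simp [TM0.step, cfg, h]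

def F1 (u : List Γ) (q : Λ) (a : Γ) (v : List Γ) : List (Sy Γ Λ) :=
  nt .X :: (tps u ++ nt (.hd q a) :: (tps v ++ [nt .E]))

def F2 (u : List Γ) (p : Λ) (c : Γ) (r : Λ) (d : Γ) (v : List Γ) : List (Sy Γ Λ) :=
  nt .X :: (tps u ++ nt (.hd p c) :: nt (.hd r d) :: (tps v ++ [nt .E]))

def Good (w : List (Sy Γ Λ)) (P : Prop) : Prop :=
  (∃ u q a v, w = F1 u q a v ∧ (Halts M (cfg u q a v) → P)) ∨
  (∃ u p c r d v, w = F2 u p c r d v ∧ adj M p c r d ∧ (Halts M (cfg u p c (d :: v)) → P)) ∨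
  (Symbol.terminal true ∈ w ∧ P)

theorem good_F1 {u q a v} {P : Prop} (hP : Halts M (cfg u q a v) → P) {w' : List (Sy Γ Λ)}
    (h : RW (IsRule0 M g0 g1) (F1 u q a v) w') : run M g1 .init w' = .dead ∨ Good M w' P := by
  rcases h with ⟨n, α, s, k1⟩ | ⟨x, s, s', k1⟩
  · cases k1
    exact .inr (.inl ⟨default :: u, q, a, v, rfl, by rwa [cfg_padl]⟩)
  rcases RW_tps _ _ _ k1 with ⟨u1, b, u2, q', rfl, rfl⟩ | ⟨r', k2, rfl⟩
  · rcases u2 with _ | ⟨b', u2⟩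
    · by_cases hadj : adj M q' b q a
      · exact .inr (.inr (.inl ⟨u1, q', b, q, a, v, rfl, hadj, fun hh => 
          hP ((adj_halts M hadj _ _).1 hh)⟩))
      · left; simp [stepS, stepN, hadj]
    · left; simp [stepS, stepN]
  rcases k2 with ⟨n, α, s, k3⟩ | ⟨x, s, s', k3⟩
  · cases k3 with
    | drop q a => left; simp [stepS, stepN]
    | write q a q' a' hw =>
      exact .inr (.inl ⟨u, q', a', v, rfl, fun hh => hP ((halts_step M (step_write M hw _ _)).2 hh)⟩)
    | halt q a hn => exact .inr (.inr (.inr ⟨by simp, hP (halts_none M hn _ _)⟩))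
  rcases RW_tps _ _ _ k3 with ⟨v1, b, v2, q', rfl, rfl⟩ | ⟨r', k4, rfl⟩
  · rcases v1 with _ | ⟨b', v1⟩
    · by_cases hadj : adj M q a q' b
      · exact .inr (.inr (.inl ⟨u, q, a, q', b, v2, rfl, hadj, hP⟩))
      · left; simp [stepS, stepN, hadj]
    · left; simp [stepS, stepN]
  rw [RW_E _ _ _ k4]
  exact .inr (.inl ⟨u, q, a, v ++ [default], by simp [F1], by rwa [cfg_padr]⟩)

theorem good_F2 {u p c r d v} {P : Prop} (hadj : adj M p c r d)
    (hP : Halts M (cfg u p c (d :: v)) → P) {w' : List (Sy Γ Λ)}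
    (h : RW (IsRule0 M g0 g1) (F2 u p c r d v) w') :
    run M g1 .init w' = .dead ∨ Good M w' P := by
  have hP2 := hP
  rw [adj_halts M hadj] at hP2
  rcases h with ⟨n, α, s, k1⟩ | ⟨x, s, s', k1⟩
  · cases k1
    exact .inr (.inr (.inl ⟨default :: u, p, c, r, d, v, rfl, hadj, by rwa [cfg_padl]⟩))
  rcases RW_tps _ _ _ k1 with ⟨u1, b, u2, q', rfl, rfl⟩ | ⟨r', k2, rfl⟩
  · left
    rcases u2 with _ | ⟨b', u2⟩
    · by_cases hadj : adj M q' b p c <;> simp [stepS, stepN, hadj]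
    · simp [stepS, stepN]
  rcases k2 with ⟨n, α, s, k3⟩ | ⟨x, s, s', k3⟩
  · cases k3 with
    | drop q a => exact .inr (.inl ⟨u ++ [c], r, d, v, by simp [F1], hP2⟩)
    | write q a q' a' hw =>
      by_cases hadj' : adj M q' a' r d
      · exact .inr (.inr (.inl ⟨u, q', a', r, d, v, rfl, hadj', fun hh =>
          hP ((halts_step M (step_write M hw _ _)).2 hh)⟩))
      · left; simp [stepS, stepN, hadj']
    | halt q a hn => exact .inr (.inr (.inr ⟨by simp, hP (halts_none M hn _ _)⟩))
  rcases k3 with ⟨n, α, s, k4⟩ | ⟨x, s, s', k4⟩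
  · cases k4 with
    | drop q a => exact .inr (.inl ⟨u, p, c, d :: v, by simp [F1], hP⟩)
    | write q a q' a' hw =>
      by_cases hadj' : adj M p c q' a'
      · exact .inr (.inr (.inl ⟨u, p, c, q', a', v, rfl, hadj', fun hh =>
          hP2 ((halts_step M (step_write M hw _ _)).2 ((adj_halts M hadj' _ _).1 hh))⟩))
      · left; simp [stepS, stepN, hadj']
    | halt q a hn => exact .inr (.inr (.inr ⟨by simp, hP2 (halts_none M hn _ _)⟩))
  rcases RW_tps _ _ _ k4 with ⟨v1, b, v2, q', rfl, rfl⟩ | ⟨r', k5, rfl⟩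
  · left
    simp [stepS, stepN, hadj]
  rw [RW_E _ _ _ k5]
  exact .inr (.inr (.inl ⟨u, p, c, r, d, v ++ [default], by simp [F2], hadj,
    by rwa [← List.cons_append, cfg_padr]⟩))

def outS : St Γ Λ → Option (Option Bool)
  | .s => none
  | .yE => some (some true)
  | .fin => none
  | .H => none
  | _ => some none

noncomputable def obs (w : List (Sy Γ Λ)) : Option (Option Bool) := outS (run M g1 .init w)

inductive Reach : List (Sy Γ Λ) → List (Option Bool) → Prop
  | nil : Reach [nt .S] ((obs M g1 [nt .S]).toList)
  | step (w w' : List (Sy Γ Λ)) (o : List (Option Bool)) (h : Reach w o) 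
    (h' : RW (IsRule M g0 g1) w w') : Reach w' (o ++ (obs M g1 w').toList)

def HK (k : ℕ) : Prop := Halts M (cfg [] default g0 (List.replicate k g1))

def Inv (w : List (Sy Γ Λ)) (o : List (Option Bool)) : Prop :=
  (w = [nt .S] ∧ o = []) ∨
  (∃ k, w = nt .Y :: (tps (List.replicate k g1) ++ [nt .E]) ∧ o = List.replicate (k+1) (some true)) ∨
  (∃ k, o = List.replicate (k+1) (some true) ∧ Good M w (HK M g0 g1 k)) ∨
  none ∈ o

theorem obs_dead {w : List (Sy Γ Λ)} (h : run M g1 .init w = .dead) : obs M g1 w = some none := by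
  rw [obs, h]; rfl

theorem obs_good {w : List (Sy Γ Λ)} {P : Prop} (h : Good M w P) : obs M g1 w = none := by
  rcases h with ⟨u, q, a, v, rfl, -⟩ | ⟨u, p, c, r, d, v, rfl, h, -⟩ | ⟨h, -⟩
  · rcases v with _ | ⟨b, v⟩ <;> simp [obs, F1, stepS, stepN, outS]
  · simp [obs, F2, stepS, stepN, outS, h]
  · rw [obs, run_mem_h _ _ _ _ h]; rfl

theorem inv_reach (hg : g1 ≠ default) {w : List (Sy Γ Λ)} {o} (h : Reach M g0 g1 w o) :
    Inv M g0 g1 w o := by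
  induction h with
  | nil => left; simp [obs, stepS, stepN, outS]
  | step w w' o h h' ih =>
    have key : run M g1 .init w' = .dead → Inv M g0 g1 w' (o ++ (obs M g1 w').toList) := by
      intro hd
      rw [obs_dead _ _ hd]
      right; right; right; simp
    have keyG : ∀ k, Good M w' (HK M g0 g1 k) → o = List.replicate (k+1) (some true) → 
        Inv M g0 g1 w' (o ++ (obs M g1 w').toList) := by
      intro k hG ho
      rw [obs_good _ _ hG]
      right; right; left; exact ⟨k, by simpa using ho, hG⟩
    by_cases hh : Symbol.terminal true ∈ w
    · have h2 := RW_mem_term h' _ hh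
      rcases ih with ⟨rfl, _⟩ | ⟨k, rfl, _⟩ | ⟨k, ho, hG⟩ | hn
      · simp at hh
      · simp at hh
      · refine keyG k (.inr (.inr ⟨h2, ?_⟩)) ho
        rcases hG with ⟨u, q, a, v, rfl, -⟩ | ⟨u, p, c, r, d, v, rfl, h, -⟩ | ⟨h, hP⟩
        · simp [F1] at hh
        · simp [F2] at hh
        · exact hP
      · right; right; right; simp [hn]
    rcases RW_cases _ _ _ h' with h' | ⟨ht, ht'⟩
    swap
    · exact key (run_mem_t _ _ _ (ht' hh) ht)
    rcases ih with ⟨rfl, rfl⟩ | ⟨k, rfl, rfl⟩ | ⟨k, ho, hG⟩ | hn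
    · rcases h' with ⟨n, α, s, h⟩ | ⟨x, s, s', h⟩
      · cases h
        right; left
        exact ⟨0, by simp, by simp [obs, stepS, stepN, outS]⟩
      · cases h
    · rcases h' with ⟨n, α, s, h⟩ | ⟨x, s, s', h⟩
      · cases h
        · right; left
          refine ⟨k + 1, by simp [List.replicate_succ], ?_⟩
          have : obs M g1 ([nt .Y, nt (.tp g1)] ++ (tps (List.replicate k g1) ++ [nt .E])) =
            some (some true) := by simp [obs, stepS, stepN, outS]
          rw [this, List.replicate_succ' (n := k + 1)]; rfl
        · refine keyG k (.inl ⟨[], default, g0, List.replicate k g1, rfl, id⟩) rfl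
      rcases RW_tps _ _ _ h with ⟨u1, b, u2, q', hu, rfl⟩ | ⟨r', h2, rfl⟩
      · refine key ?_
        obtain ⟨j, rfl⟩ : ∃ j, u1 = List.replicate j g1 := by
          refine ⟨u1.length, List.eq_replicate_iff.2 ⟨rfl, fun x hx => ?_⟩⟩
          refine List.eq_of_mem_replicate (n := k) ?_
          rw [hu]; simp [hx]
        simp [stepS, stepN]
      · refine key ?_
        rw [RW_E _ _ _ h2]
        simp [stepS, stepN, hg.symm]
    · have : run M g1 .init w' = .dead ∨ Good M w' (HK M g0 g1 k) := by
        rcases hG with ⟨u, q, a, v, rfl, hP⟩ | ⟨u, p, c, r, d, v, rfl, h, hP⟩ | ⟨h, hP⟩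
        · exact good_F1 _ _ _ hP h'
        · exact good_F2 _ _ _ h hP h'
        · exact absurd h hh
      rcases this with h | h
      · exact key h
      · exact keyG k h ho
    · right; right; right; simp [hn]

theorem sound (hg : g1 ≠ default) {t : List Bool} {k : ℕ}
    (h : Reach M g0 g1 (t.map Symbol.terminal) (List.replicate (k+1) (some true))) :
    HK M g0 g1 k := by
  have no_nt : ∀ n, nt n ∉ (t.map Symbol.terminal : List (Sy Γ Λ)) := by simp
  rcases inv_reach M g0 g1 hg h with ⟨h, _⟩ | ⟨k, h, _⟩ | ⟨k', ho, hG⟩ | hn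
  · exact absurd (by simp [h]) (no_nt .S)
  · exact absurd (by simp [h]) (no_nt .Y)
  · have : k = k' := by simpa using congrArg List.length ho
    subst this
    rcases hG with ⟨u, q, a, v, h, -⟩ | ⟨u, p, c, r, d, v, h, -⟩ | ⟨h, hP⟩
    · exact absurd (by simp [h, F1]) (no_nt .X)
    · exact absurd (by simp [h, F2]) (no_nt .X)
    · exact hP
  · simp at hn

/-! completeness -/

theorem reach_silent {w w' : List (Sy Γ Λ)} {o} (h : Reach M g0 g1 w o)
    (h' : RW (IsRule M g0 g1) w w') (ho : obs M g1 w' = none) : Reach M g0 g1 w' o := by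
  have := Reach.step _ _ _ h h'
  rwa [ho, Option.toList_none, List.append_nil] at this

theorem reach_good {w : List (Sy Γ Λ)} {o} (h : Reach M g0 g1 w o) (p : List (Sy Γ Λ)) 
    {n α s} (hr : IsRule0 M g0 g1 n α)
    (hw : w = p ++ nt n :: s) (hG : Good M (p ++ (α ++ s)) True) :
    Reach M g0 g1 (p ++ (α ++ s)) o := by
  subst hw
  exact reach_silent _ _ _ h (RW.at p (.inl hr)) (obs_good _ _ hG)

theorem reach_clean (s : List (Sy Γ Λ)) (t : List Bool) (o)
    (h : Reach M g0 g1 (t.map Symbol.terminal ++ s) o)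
    (hh : Symbol.terminal true ∈ (t.map Symbol.terminal ++ s)) : 
    ∃ t : List Bool, Reach M g0 g1 (t.map Symbol.terminal) o := by
  induction s generalizing t with
  | nil => exact ⟨t, by simpa using h⟩
  | cons x s ih =>
    rcases x with (b | n)
    · refine ih (t ++ [b]) (by simpa using h) (by simpa using hh)
    · have h1 : RW (IsRule M g0 g1) (t.map Symbol.terminal ++ nt n :: s) 
        (t.map Symbol.terminal ++ ([.terminal false] ++ s)) := RW.at _ (.inr rfl)
      have h2 := RW_mem_term h1 _ hh
      have h3 := reach_silent _ _ _ h h1 (obs_good _ _ (P := True) (.inr (.inr ⟨h2, trivial⟩)))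
      refine ih (t ++ [false]) (by simpa using h3) (by simpa using h2)

theorem reach_y (k : ℕ) : Reach M g0 g1 (nt .Y :: (tps (List.replicate k g1) ++ [nt .E]))
    (List.replicate (k+1) (some true)) := by
  induction k with
  | zero =>
    have := Reach.step _ _ _ (Reach.nil (M := M) (g0 := g0) (g1 := g1))
      (RW.at [] (s := []) (.inl IsRule0.S))
    simpa [obs, stepS, stepN, outS] using this
  | succ k ih =>
    have := Reach.step _ _ _ ih (RW.at [] (.inl IsRule0.Y))
    rw [List.replicate_succ' (n := k + 1)]
    simpa [obs, stepS, stepN, outS, List.replicate_succ (n := k)] using this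

theorem reach_init (k : ℕ) : Reach M g0 g1 (F1 [] default g0 (List.replicate k g1))
    (List.replicate (k+1) (some true)) := 
  reach_good _ _ _ (reach_y M g0 g1 k) [] IsRule0.Yx rfl
    (.inl ⟨[], default, g0, List.replicate k g1, rfl, fun _ => trivial⟩)

theorem reach_right {u p c r d v o} (h : Reach M g0 g1 (F1 u p c (d :: v)) o)
    (hm : M p c = some (r, .move .right)) : Reach M g0 g1 (F1 (u ++ [c]) r d v) o := by
  have h1 : Reach M g0 g1 (F2 u p c r d v) o := by
    have := reach_good _ _ _ h (nt .X :: (tps u ++ [nt (.hd p c)])) (s := tps v ++ [nt .E])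
      (IsRule0.act r d) (by simp [F1])
      (.inr (.inl ⟨u, p, c, r, d, v, by simp [F2], .inl hm, fun _ => trivial⟩))
    simpa [F2] using this
  have := reach_good _ _ _ h1 (nt .X :: tps u) (s := nt (.hd r d) :: (tps v ++ [nt .E]))
      (IsRule0.drop p c) (by simp [F2])
      (.inl ⟨u ++ [c], r, d, v, by simp [F1], fun _ => trivial⟩)
  simpa [F1] using this

theorem reach_left {u p c r d v o} (h : Reach M g0 g1 (F1 (u ++ [c]) r d v) o)
    (hm : M r d = some (p, .move .left)) : Reach M g0 g1 (F1 u p c (d :: v)) o := by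
  have h1 : Reach M g0 g1 (F2 u p c r d v) o := by
    have := reach_good _ _ _ h (nt .X :: (tps u)) (s := nt (.hd r d) :: (tps v ++ [nt .E]))
      (IsRule0.act p c) (by simp [F1])
      (.inr (.inl ⟨u, p, c, r, d, v, by simp [F2], .inr hm, fun _ => trivial⟩))
    simpa [F2] using this
  have := reach_good _ _ _ h1 (nt .X :: (tps u ++ [nt (.hd p c)])) (s := tps v ++ [nt .E])
      (IsRule0.drop r d) (by simp [F2])
      (.inl ⟨u, p, c, d :: v, by simp [F1], fun _ => trivial⟩)
  simpa [F1] using this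

theorem reach_padl {u q a v o} (h : Reach M g0 g1 (F1 u q a v) o) :
    Reach M g0 g1 (F1 (default :: u) q a v) o :=
  reach_good _ _ _ h [] IsRule0.X rfl (.inl ⟨default :: u, q, a, v, rfl, fun _ => trivial⟩)

theorem reach_padr {u q a v o} (h : Reach M g0 g1 (F1 u q a v) o) :
    Reach M g0 g1 (F1 u q a (v ++ [default])) o := by
  have := reach_good _ _ _ h (nt .X :: (tps u ++ nt (.hd q a) :: tps v)) (s := []) IsRule0.E
    (by simp [F1]) (.inl ⟨u, q, a, v ++ [default], by simp [F1], fun _ => trivial⟩)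
  simpa [F1] using this

theorem reach_step {u q a v o c'} (h : Reach M g0 g1 (F1 u q a v) o)
    (hs : TM0.step M (cfg u q a v) = some c') :
    ∃ u' q' a' v', c' = cfg u' q' a' v' ∧ Reach M g0 g1 (F1 u' q' a' v') o := by
  rcases hm : M q a with _ | ⟨q', d | a'⟩
  · simp [TM0.step, cfg, hm] at hs
  · cases d
    · obtain ⟨u1, c, e, h⟩ : ∃ u1 c, cfg u q a v = cfg (u1 ++ [c]) q a v ∧ 
          Reach M g0 g1 (F1 (u1 ++ [c]) q a v) o := by
        rcases List.eq_nil_or_concat u with rfl | ⟨u1, c, rfl⟩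
        · exact ⟨[], default, (cfg_padl _ _ _ _).symm, reach_padl _ _ _ h⟩
        · exact ⟨u1, c, by simp, by simpa using h⟩
      rw [e, step_left M hm] at hs
      exact ⟨_, _, _, _, (Option.some.inj hs).symm, reach_left _ _ _ h hm⟩
    · obtain ⟨d, v1, e, h⟩ : ∃ d v1, cfg u q a v = cfg u q a (d :: v1) ∧ 
          Reach M g0 g1 (F1 u q a (d :: v1)) o := by
        rcases v with _ | ⟨d, v1⟩
        · exact ⟨default, [], (cfg_padr _ _ _ _).symm, reach_padr _ _ _ h⟩
        · exact ⟨d, v1, rfl, h⟩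
      rw [e, step_right M hm] at hs
      exact ⟨_, _, _, _, (Option.some.inj hs).symm, reach_right _ _ _ h hm⟩
  · rw [step_write M hm] at hs
    refine ⟨_, _, _, _, (Option.some.inj hs).symm, ?_⟩
    exact reach_good _ _ _ h (nt .X :: tps u) (IsRule0.write q a q' a' hm) rfl
      (.inl ⟨u, q', a', v, rfl, fun _ => trivial⟩)

theorem complete {k : ℕ} (h : HK M g0 g1 k) :
    ∃ t : List Bool, Reach M g0 g1 (t.map Symbol.terminal) (List.replicate (k+1) (some true)) := by
  obtain ⟨c, hc⟩ := Part.dom_iff_mem.1 h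
  obtain ⟨hr, hn⟩ := StateTransition.mem_eval.1 hc
  have : ∃ u q a v, c = cfg u q a v ∧ 
      Reach M g0 g1 (F1 u q a v) (List.replicate (k+1) (some true)) := by
    clear hn hc
    induction hr with
    | refl => exact ⟨_, _, _, _, rfl, reach_init M g0 g1 k⟩
    | tail _ hs ih =>
      obtain ⟨u, q, a, v, rfl, h⟩ := ih
      exact reach_step _ _ _ h hs
  obtain ⟨u, q, a, v, rfl, h⟩ := this
  have hm : M q a = none := by simpa [TM0.step, cfg] using hn
  have hmem : Symbol.terminal true ∈ 
    ((nt .X :: tps u) ++ ([.terminal true] ++ (tps v ++ [nt .E])) : List (Sy Γ Λ)) := by simp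
  have := reach_good _ _ _ h (nt .X :: tps u) (IsRule0.halt q a hm) rfl
    (.inr (.inr ⟨hmem, trivial⟩))
  exact reach_clean _ _ _ _ [] _ this hmem

/-! grammar -/

theorem rules_finite [Finite Γ] [Finite Λ] :
    {r : ContextFreeRule Bool (NTm Γ Λ) | IsRule M g0 g1 r.input r.output}.Finite := by
  have hS : Finite (Sy Γ Λ) := by
    refine Finite.of_surjective (α := Bool ⊕ NTm Γ Λ)
      (Sum.elim Symbol.terminal Symbol.nonterminal) ?_
    intro x
    rcases x with (b | n)
    exacts [⟨.inl b, rfl⟩, ⟨.inr n, rfl⟩]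
  have h1 : ((Set.univ : Set (NTm Γ Λ)) ×ˢ {l : List (Sy Γ Λ) | l.length ≤ 2}).Finite :=
    Set.Finite.prod Set.finite_univ (List.finite_length_le _ 2)
  refine Set.Finite.of_finite_image (f := fun r => (r.input, r.output)) (h1.subset ?_) ?_
  · rintro _ ⟨⟨n, l⟩, hr, rfl⟩
    refine ⟨trivial, ?_⟩
    have hr : IsRule M g0 g1 n l := hr
    show l.length ≤ 2
    rcases hr with hr | rfl
    · cases hr <;> simp
    · simp
  · rintro ⟨a, b⟩ _ ⟨a', b'⟩ _ h
    simpa using h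

noncomputable def gram [Finite Γ] [Finite Λ] : ContextFreeGrammar Bool where
  NT := NTm Γ Λ
  initial := .S
  rules := (rules_finite M g0 g1).toFinset

theorem produces_iff [Finite Γ] [Finite Λ] (w w' : List (Sy Γ Λ)) :
    (gram M g0 g1).Produces w w' ↔ RW (IsRule M g0 g1) w w' := by
  constructor
  · rintro ⟨r, hr, h⟩
    have hr : IsRule M g0 g1 r.input r.output :=
      (rules_finite M g0 g1).mem_toFinset.1 hr
    induction h with
    | head s => exact .head _ _ _ hr
    | cons x _ ih => exact .cons _ _ _ ih
  · intro h
    induction h with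
    | head n α s h =>
      exact ⟨⟨n, α⟩, (rules_finite M g0 g1).mem_toFinset.2 h, .head s⟩
    | cons x s s' h ih =>
      obtain ⟨r, hr, h⟩ := ih
      exact ⟨r, hr, .cons x h⟩

theorem mem_goLang_iff [Finite Γ] [Finite Λ] (x : List (Option Bool)) :
    x ∈ goLang (gram M g0 g1) (obs M g1) ↔
      ∃ t : List Bool, Reach M g0 g1 (t.map Symbol.terminal) x := by
  constructor
  · rintro ⟨ws, hh, hc, ⟨t, ht⟩, rfl⟩
    refine ⟨t, ?_⟩
    have aux : ∀ (ws : List (List (Sy Γ Λ))) (w : List (Sy Γ Λ)), ws.head? = some [nt .S] →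
        List.IsChain (RW (IsRule M g0 g1)) ws → ws.getLast? = some w →
        Reach M g0 g1 w (ws.map fun w => (obs M g1 w).toList).flatten := by
      clear hh hc ht ws
      intro ws
      induction ws using List.reverseRecOn with
      | nil => intro w hh; simp at hh
      | append_singleton ws y ih =>
        intro w hh hc ht
        have : y = w := by simpa using ht
        subst this
        rcases List.eq_nil_or_concat ws with rfl | ⟨ws', z, rfl⟩
        · have : y = [nt .S] := by simpa using hh
          subst this
          simpa using Reach.nil (M := M) (g0 := g0) (g1 := g1)
        · rw [List.concat_eq_append] at *
          have hc2 := List.isChain_append.1 hc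
          have := ih z (by simpa [List.head?_append] using hh) hc2.1 (by simp)
          have h3 := Reach.step _ y _ this (hc2.2.2 z (by simp) y (by simp))
          rw [List.map_append, List.flatten_append]
          simpa using h3
    have hc' : List.IsChain (RW (IsRule M g0 g1)) ws :=
      List.IsChain.imp (fun a b h => (produces_iff M g0 g1 a b).1 h) hc
    exact aux ws _ hh hc' ht
  · rintro ⟨t, h⟩
    have : ∃ ws : List (List (Sy Γ Λ)), ws.head? = some [nt .S] ∧
        List.IsChain (gram M g0 g1).Produces ws ∧ ws.getLast? = some (t.map Symbol.terminal) ∧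
        x = (ws.map fun w => (obs M g1 w).toList).flatten := by
      generalize (t.map Symbol.terminal : List (Sy Γ Λ)) = w at h
      induction h with
      | nil => exact ⟨[[nt .S]], rfl, .singleton _, rfl, by simp⟩
      | step w w' o h h' ih =>
        obtain ⟨ws, h1, h2, h3, rfl⟩ := ih
        refine ⟨ws ++ [w'], by simp [List.head?_append, h1], ?_, by simp, by simp⟩
        refine List.isChain_append.2 ⟨h2, .singleton _, ?_⟩
        intro a ha b hb
        have hb : w' = b := Option.some.inj hb
        have ha : w = a := Option.some.inj (h3.symm.trans ha)
        subst ha hb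
        exact (produces_iff _ _ _ _ _).2 h'
    obtain ⟨ws, h1, h2, h3, h4⟩ := this
    exact ⟨ws, h1, h2, ⟨t, h3⟩, h4⟩

theorem obs_regular [Finite Γ] [Finite Λ] : ObserverRegular (obs (Λ := Λ) M g1) := by
  intro o
  have := Fintype.ofFinite (St Γ Λ)
  refine ⟨St Γ Λ, this, ⟨stepS M g1, .init, {s | outS s = o}⟩, ?_⟩
  ext w
  rfl

theorem init_eq (k : ℕ) : (TM0.init (g0 :: List.replicate k g1) : TM0.Cfg Γ Λ) =
    cfg [] default g0 (List.replicate k g1) := by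
  rfl

end

end GO

theorem exists_goLang_not_recursive :
    ∃ (T : Type) (_ : Finite T) (G : ContextFreeGrammar T) (_ : Finite G.NT)
      (A : List (Symbol T G.NT) → Option (Option Bool)),
      ObserverRegular A ∧ ¬ ComputablePred (fun x => x ∈ goLang G A) := by
  obtain ⟨c, hc⟩ := exists_TM2
  obtain ⟨Γ, Λ, _, _, _, _, M, g0, g1, hg, hM⟩ := exists_TM0 c
  refine ⟨Bool, inferInstance, GO.gram M g0 g1, GO.finNTm, GO.obs M g1, GO.obs_regular M g1, ?_⟩
  intro hcomp
  refine halts_undec ?_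
  have hrep : Computable (fun k : ℕ => (List.replicate (k+1) (some true) : List (Option Bool))) := by
    have : Primrec (fun k : ℕ => (Nat.rec [] (fun _ l => some true :: l) k : List (Option Bool))) := 
      Primrec.nat_rec₁ [] (Primrec.list_cons.comp (Primrec.const _) Primrec.snd)
    refine ((this.comp Primrec.succ).to_comp).of_eq fun k => ?_
    have : ∀ k : ℕ, (Nat.rec [] (fun _ l => some true :: l) k : List (Option Bool)) = List.replicate k (some true) := by
      intro k
      induction k with
      | zero => rfl
      | succ k ih => rw [List.replicate_succ, ← ih]
    exact this (k+1)
  refine ComputablePred.computable_of_manyOneReducible ⟨_, hrep, fun k => ?_⟩ hcomp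
  show (fOnes (eOnes k)).Dom ↔ _
  rw [← hc, ← hM, GO.init_eq, GO.mem_goLang_iff]
  exact ⟨fun h => GO.complete M g0 g1 h, fun ⟨t, h⟩ => GO.sound M g0 g1 hg h⟩
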